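/- In the course of proving the counting theorem for constituents of χ_λ, the following identity holds: for every λ ∈ 𝔫*, Ind_{L_λ}^{S_λ}(θ_λ) = Σ_{ν ∈ 𝒪} θ_ν, where 𝒪 = {ν restricted to 𝔰_λ : ν ∈ λG} ⊆ (𝔰_λ)*; moreover for each κ ∈ (𝔰_λ)*, the set {ν ∈ λG : ν restricted to 𝔰_λ equals κ} is either empty or has cardinality |G|/|S_λ|. -/

import Mathlib

open scoped Classical BigOperators ComplexOrder

set_option linter.unusedSectionVars false
set_option linter.unusedVariables false

noncomputable section

namespace IterChar

/-! ### Generic notions for finite groups: inner product, induction, characters -/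

/-- The standard inner product `⟨f,h⟩_G = |G|⁻¹ ∑_{x ∈ G} f x * conj (h x)`. -/
def innerG (G : Type) [Group G] (f h : G → ℂ) : ℂ :=
  (Nat.card G : ℂ)⁻¹ * ∑ᶠ x : G, f x * (starRingEnd ℂ) (h x)

/-- Induction of a function from a subgroup, via the Frobenius formula. -/
def indFun {G : Type} [Group G] (H : Subgroup G) (ψ : ↥H → ℂ) : G → ℂ :=
  fun g => (Nat.card ↥H : ℂ)⁻¹ *
    ∑ᶠ x : G, if h : x * g * x⁻¹ ∈ H then ψ ⟨x * g * x⁻¹, h⟩ else 0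

/-- A function `G → ℂ` is a character if it is the trace character of some
finite-dimensional complex representation. -/
def IsCharacter (G : Type) [Group G] (f : G → ℂ) : Prop :=
  ∃ V : FDRep ℂ G, f = FDRep.character V

/-- The set of irreducible characters of `G`: characters of norm one. -/
def Irr (G : Type) [Group G] : Set (G → ℂ) :=
  {f | IsCharacter G f ∧ innerG G f f = 1}

/-- The set of irreducible constituents of `χ`: irreducible characters with
`⟨χ, ψ⟩_G > 0` (using the complex partial order). -/
def IrrConstituents (G : Type) [Group G] (χ : G → ℂ) : Set (G → ℂ) :=
  {f | f ∈ Irr G ∧ 0 < innerG G χ f}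

/-! ### Algebra groups -/

variable {F : Type} [Field F] [Fintype F] {R : Type} [Ring R] [Algebra F R] [Fintype R]

/-- `J` is a nilpotent (non-unital) subalgebra: all products of some fixed length vanish. -/
def IsNil (J : NonUnitalSubalgebra F R) : Prop :=
  ∃ N : ℕ, ∀ l : List R, (∀ x ∈ l, x ∈ J) → l.length = N → l.prod = 0

/-- The algebra group `G = 1 + J` of a (nilpotent) subalgebra `J ⊆ R`, realized as the
subgroup of units `u` of `R` with `u - 1 ∈ J` (and `u⁻¹ - 1 ∈ J`, which is automatic
when `J` is nilpotent). -/
def algGroup (F : Type) [Field F] [Fintype F] (R : Type) [Ring R] [Algebra F R] [Fintype R]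
    (J : NonUnitalSubalgebra F R) : Subgroup Rˣ where
  carrier := {u : Rˣ | ((u : R) - 1 ∈ J) ∧ (((u⁻¹ : Rˣ) : R) - 1 ∈ J)}
  one_mem' := by
    constructor <;> · simp only [Units.val_one, inv_one, sub_self]; exact J.zero_mem
  mul_mem' := by
    rintro u v ⟨hu1, hu2⟩ ⟨hv1, hv2⟩
    constructor
    · have h : ((u * v : Rˣ) : R) - 1 =
          ((u : R) - 1) * ((v : R) - 1) + ((u : R) - 1) + ((v : R) - 1) := by
        push_cast; noncomm_ring
      rw [h]
      exact add_mem (add_mem (mul_mem hu1 hv1) hu1) hv1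
    · have h : (((u * v)⁻¹ : Rˣ) : R) - 1 =
          (((v⁻¹ : Rˣ) : R) - 1) * (((u⁻¹ : Rˣ) : R) - 1) +
            (((v⁻¹ : Rˣ) : R) - 1) + (((u⁻¹ : Rˣ) : R) - 1) := by
        rw [mul_inv_rev]; push_cast; noncomm_ring
      rw [h]
      exact add_mem (add_mem (mul_mem hv2 hu2) hv2) hu2
  inv_mem' := by
    rintro u ⟨h1, h2⟩
    exact ⟨h2, by simpa using h1⟩

theorem mem_algGroup {J : NonUnitalSubalgebra F R} {u : Rˣ} :
    u ∈ algGroup F R J ↔ ((u : R) - 1 ∈ J) ∧ (((u⁻¹ : Rˣ) : R) - 1 ∈ J) :=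
  Iff.rfl

/-- The element `X ∈ J` such that `g = 1 + X`. -/
def gElt {J : NonUnitalSubalgebra F R} (g : ↥(algGroup F R J)) : ↥J :=
  ⟨((g : Rˣ) : R) - 1, g.2.1⟩

/-- The function `θ_λ(1+X) = θ(λ(X))` on the algebra group `1 + J`. -/
def thetaFn (θ : AddChar F ℂ) (J : NonUnitalSubalgebra F R) (lam : ↥J →ₗ[F] F) :
    ↥(algGroup F R J) → ℂ :=
  fun g => θ (lam (gElt g))

/-- Left multiplication by the group element `g` as a linear endomorphism of `J`. -/
def lmulMap {J : NonUnitalSubalgebra F R} (g : ↥(algGroup F R J)) : ↥J →ₗ[F] ↥J where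
  toFun X := ⟨((g : Rˣ) : R) * (X : R), by
    have h : ((g : Rˣ) : R) * (X : R) = (((g : Rˣ) : R) - 1) * (X : R) + (X : R) := by
      noncomm_ring
    rw [h]; exact add_mem (mul_mem g.2.1 X.2) X.2⟩
  map_add' X Y := by ext; simp [mul_add]
  map_smul' c X := by ext; simp [mul_smul_comm]

/-- Right multiplication by the group element `g` as a linear endomorphism of `J`. -/
def rmulMap {J : NonUnitalSubalgebra F R} (g : ↥(algGroup F R J)) : ↥J →ₗ[F] ↥J where
  toFun X := ⟨(X : R) * ((g : Rˣ) : R), by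
    have h : (X : R) * ((g : Rˣ) : R) = (X : R) * (((g : Rˣ) : R) - 1) + (X : R) := by
      noncomm_ring
    rw [h]; exact add_mem (mul_mem X.2 g.2.1) X.2⟩
  map_add' X Y := by ext; simp [add_mul]
  map_smul' c X := by ext; simp [smul_mul_assoc]

/-- The left action of `G` on the dual space: `(gλ)(X) = λ(g⁻¹ X)`. -/
def leftAct {J : NonUnitalSubalgebra F R} (g : ↥(algGroup F R J)) (lam : ↥J →ₗ[F] F) :
    ↥J →ₗ[F] F :=
  lam.comp (lmulMap g⁻¹)

/-- The right action of `G` on the dual space: `(λg)(X) = λ(X g⁻¹)`. -/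
def rightAct {J : NonUnitalSubalgebra F R} (g : ↥(algGroup F R J)) (lam : ↥J →ₗ[F] F) :
    ↥J →ₗ[F] F :=
  lam.comp (rmulMap g⁻¹)

/-- The coadjoint action of `G` on the dual space: `λ^g(X) = λ(g X g⁻¹)`. -/
def coAct {J : NonUnitalSubalgebra F R} (g : ↥(algGroup F R J)) (lam : ↥J →ₗ[F] F) :
    ↥J →ₗ[F] F :=
  lam.comp ((lmulMap g).comp (rmulMap g⁻¹))

/-- The left orbit `Gλ`. -/
def leftOrbit (J : NonUnitalSubalgebra F R) (lam : ↥J →ₗ[F] F) : Set (↥J →ₗ[F] F) :=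
  Set.range fun g : ↥(algGroup F R J) => leftAct g lam

/-- The right orbit `λG`. -/
def rightOrbit (J : NonUnitalSubalgebra F R) (lam : ↥J →ₗ[F] F) : Set (↥J →ₗ[F] F) :=
  Set.range fun g : ↥(algGroup F R J) => rightAct g lam

/-- The two-sided orbit `GλG`. -/
def twoOrbit (J : NonUnitalSubalgebra F R) (lam : ↥J →ₗ[F] F) : Set (↥J →ₗ[F] F) :=
  {mu | ∃ g h : ↥(algGroup F R J), mu = leftAct g (rightAct h lam)}

/-- The coadjoint orbit `λ^G`. -/
def coOrbit (J : NonUnitalSubalgebra F R) (lam : ↥J →ₗ[F] F) : Set (↥J →ₗ[F] F) :=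
  Set.range fun g : ↥(algGroup F R J) => coAct g lam

/-- The right orbit of `λ` under a subgroup `H` of the algebra group. -/
def rightOrbitUnder (J : NonUnitalSubalgebra F R) (H : Subgroup ↥(algGroup F R J))
    (lam : ↥J →ₗ[F] F) : Set (↥J →ₗ[F] F) :=
  {mu | ∃ s ∈ H, mu = rightAct s lam}

/-- The Kirillov function `ψ_λ = |λ^G|^{-1/2} ∑_{μ ∈ λ^G} θ_μ`. -/
def kirillov (θ : AddChar F ℂ) (J : NonUnitalSubalgebra F R) (lam : ↥J →ₗ[F] F) :
    ↥(algGroup F R J) → ℂ :=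
  fun g => ((Real.sqrt (Nat.card ↥(coOrbit J lam)) : ℂ))⁻¹ *
    ∑ᶠ mu ∈ coOrbit J lam, thetaFn θ J mu g

/-- The supercharacter `χ_λ = (|Gλ|/|GλG|) ∑_{μ ∈ GλG} θ_μ`. -/
def superchar (θ : AddChar F ℂ) (J : NonUnitalSubalgebra F R) (lam : ↥J →ₗ[F] F) :
    ↥(algGroup F R J) → ℂ :=
  fun g => ((Nat.card ↥(leftOrbit J lam) : ℂ) / (Nat.card ↥(twoOrbit J lam) : ℂ)) *
    ∑ᶠ mu ∈ twoOrbit J lam, thetaFn θ J mu g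

/-! ### The subalgebras `𝔩_λ`, `𝔰_λ` and their iterates -/

/-- The extension of `λ : J → F` by zero to all of `R`. -/
def lamE (J : NonUnitalSubalgebra F R) (lam : ↥J →ₗ[F] F) (x : R) : F :=
  if h : x ∈ J then lam ⟨x, h⟩ else 0

theorem lamE_apply (J : NonUnitalSubalgebra F R) (lam : ↥J →ₗ[F] F) {x : R} (hx : x ∈ J) :
    lamE J lam x = lam ⟨x, hx⟩ := dif_pos hx

theorem lamE_zero (J : NonUnitalSubalgebra F R) (lam : ↥J →ₗ[F] F) : lamE J lam 0 = 0 := by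
  rw [lamE_apply J lam J.zero_mem]
  have h : (⟨(0 : R), J.zero_mem⟩ : ↥J) = 0 := Subtype.ext rfl
  rw [h, map_zero]

theorem lamE_add (J : NonUnitalSubalgebra F R) (lam : ↥J →ₗ[F] F) {x y : R}
    (hx : x ∈ J) (hy : y ∈ J) : lamE J lam (x + y) = lamE J lam x + lamE J lam y := by
  rw [lamE, lamE, lamE, dif_pos (add_mem hx hy), dif_pos hx, dif_pos hy]
  have h : (⟨x + y, add_mem hx hy⟩ : ↥J) = ⟨x, hx⟩ + ⟨y, hy⟩ := Subtype.ext rfl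
  rw [h, map_add]

theorem lamE_smul (J : NonUnitalSubalgebra F R) (lam : ↥J →ₗ[F] F) (c : F) {x : R}
    (hx : x ∈ J) : lamE J lam (c • x) = c * lamE J lam x := by
  rw [lamE, lamE, dif_pos (SMulMemClass.smul_mem c hx), dif_pos hx]
  have h : (⟨c • x, SMulMemClass.smul_mem c hx⟩ : ↥J) = c • ⟨x, hx⟩ := Subtype.ext rfl
  rw [h, map_smul]
  rfl

/-- The left kernel `𝔩` of the bilinear form `(X,Y) ↦ λ(XY)` restricted to `s × s`. -/
def lStep (J : NonUnitalSubalgebra F R) (lam : ↥J →ₗ[F] F)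
    (s : NonUnitalSubalgebra F R) (hs : s ≤ J) : NonUnitalSubalgebra F R where
  carrier := {x | x ∈ s ∧ ∀ y ∈ s, lamE J lam (x * y) = 0}
  zero_mem' := ⟨zero_mem s, fun y _ => by rw [zero_mul, lamE_zero]⟩
  add_mem' := by
    rintro a b ⟨ha1, ha2⟩ ⟨hb1, hb2⟩
    refine ⟨add_mem ha1 hb1, fun y hy => ?_⟩
    rw [add_mul, lamE_add J lam (J.mul_mem (hs ha1) (hs hy)) (J.mul_mem (hs hb1) (hs hy)),
      ha2 y hy, hb2 y hy, add_zero]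
  smul_mem' := by
    rintro c a ⟨ha1, ha2⟩
    refine ⟨SMulMemClass.smul_mem c ha1, fun y hy => ?_⟩
    rw [smul_mul_assoc, lamE_smul J lam c (J.mul_mem (hs ha1) (hs hy)), ha2 y hy, mul_zero]
  mul_mem' := by
    rintro a b ⟨ha1, ha2⟩ ⟨hb1, hb2⟩
    refine ⟨mul_mem ha1 hb1, fun y hy => ?_⟩
    rw [mul_assoc]
    exact ha2 (b * y) (mul_mem hb1 hy)

theorem lStep_le (J : NonUnitalSubalgebra F R) (lam : ↥J →ₗ[F] F)
    (s : NonUnitalSubalgebra F R) (hs : s ≤ J) : lStep J lam s hs ≤ s :=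
  fun _ hx => hx.1

/-- The left kernel `𝔰` of the bilinear form `(X,Y) ↦ λ(XY)` restricted to `s × 𝔩`. -/
def sStep (J : NonUnitalSubalgebra F R) (lam : ↥J →ₗ[F] F)
    (s : NonUnitalSubalgebra F R) (hs : s ≤ J) : NonUnitalSubalgebra F R where
  carrier := {x | x ∈ s ∧ ∀ y ∈ lStep J lam s hs, lamE J lam (x * y) = 0}
  zero_mem' := ⟨zero_mem s, fun y _ => by rw [zero_mul, lamE_zero]⟩
  add_mem' := by
    rintro a b ⟨ha1, ha2⟩ ⟨hb1, hb2⟩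
    refine ⟨add_mem ha1 hb1, fun y hy => ?_⟩
    rw [add_mul, lamE_add J lam (J.mul_mem (hs ha1) (hs hy.1)) (J.mul_mem (hs hb1) (hs hy.1)),
      ha2 y hy, hb2 y hy, add_zero]
  smul_mem' := by
    rintro c a ⟨ha1, ha2⟩
    refine ⟨SMulMemClass.smul_mem c ha1, fun y hy => ?_⟩
    rw [smul_mul_assoc, lamE_smul J lam c (J.mul_mem (hs ha1) (hs hy.1)), ha2 y hy, mul_zero]
  mul_mem' := by
    rintro a b ⟨ha1, ha2⟩ ⟨hb1, hb2⟩
    refine ⟨mul_mem ha1 hb1, fun y hy => ?_⟩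
    rw [mul_assoc]
    refine ha2 (b * y) ⟨mul_mem hb1 hy.1, fun z hz => ?_⟩
    rw [mul_assoc]
    refine hb2 (y * z) ⟨mul_mem hy.1 hz, fun w hw => ?_⟩
    rw [mul_assoc]
    exact hy.2 (z * w) (mul_mem hz hw)

theorem sStep_le (J : NonUnitalSubalgebra F R) (lam : ↥J →ₗ[F] F)
    (s : NonUnitalSubalgebra F R) (hs : s ≤ J) : sStep J lam s hs ≤ s :=
  fun _ hx => hx.1

/-- `𝔩_λ`: the left kernel of `(X,Y) ↦ λ(XY)` on `J × J`. -/
def lone (J : NonUnitalSubalgebra F R) (lam : ↥J →ₗ[F] F) : NonUnitalSubalgebra F R :=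
  lStep J lam J le_rfl

/-- `𝔰_λ`: the left kernel of `(X,Y) ↦ λ(XY)` on `J × 𝔩_λ`. -/
def sone (J : NonUnitalSubalgebra F R) (lam : ↥J →ₗ[F] F) : NonUnitalSubalgebra F R :=
  sStep J lam J le_rfl

theorem lone_le (J : NonUnitalSubalgebra F R) (lam : ↥J →ₗ[F] F) : lone J lam ≤ J :=
  lStep_le J lam J le_rfl

theorem sone_le (J : NonUnitalSubalgebra F R) (lam : ↥J →ₗ[F] F) : sone J lam ≤ J :=
  sStep_le J lam J le_rfl

/-- `𝔨_λ = 𝔩_λ ∩ ker λ`. -/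
def kone (J : NonUnitalSubalgebra F R) (lam : ↥J →ₗ[F] F) : NonUnitalSubalgebra F R where
  carrier := {x | x ∈ lone J lam ∧ lamE J lam x = 0}
  zero_mem' := ⟨zero_mem _, lamE_zero J lam⟩
  add_mem' := by
    rintro a b ⟨ha1, ha2⟩ ⟨hb1, hb2⟩
    exact ⟨add_mem ha1 hb1, by
      rw [lamE_add J lam (lone_le J lam ha1) (lone_le J lam hb1), ha2, hb2, add_zero]⟩
  smul_mem' := by
    rintro c a ⟨ha1, ha2⟩
    exact ⟨SMulMemClass.smul_mem c ha1, by
      rw [lamE_smul J lam c (lone_le J lam ha1), ha2, mul_zero]⟩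
  mul_mem' := by
    rintro a b ⟨ha1, ha2⟩ ⟨hb1, hb2⟩
    exact ⟨mul_mem ha1 hb1, ha1.2 b (lone_le J lam hb1)⟩

theorem kone_le (J : NonUnitalSubalgebra F R) (lam : ↥J →ₗ[F] F) : kone J lam ≤ lone J lam :=
  fun _ hx => hx.1

/-- The descending chain `𝔰_λ^0 ⊇ 𝔰_λ^1 ⊇ ⋯` (bundled with the proof `𝔰_λ^i ≤ J`). -/
def sChainAux (J : NonUnitalSubalgebra F R) (lam : ↥J →ₗ[F] F) :
    ℕ → {s : NonUnitalSubalgebra F R // s ≤ J}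
  | 0 => ⟨J, le_rfl⟩
  | n + 1 =>
    ⟨sStep J lam (sChainAux J lam n).1 (sChainAux J lam n).2,
      le_trans (sStep_le J lam (sChainAux J lam n).1 (sChainAux J lam n).2)
        (sChainAux J lam n).2⟩

/-- `𝔰_λ^i`. -/
def sChain (J : NonUnitalSubalgebra F R) (lam : ↥J →ₗ[F] F) (i : ℕ) :
    NonUnitalSubalgebra F R :=
  (sChainAux J lam i).1

/-- `𝔩_λ^{i+1}`. -/
def lChain (J : NonUnitalSubalgebra F R) (lam : ↥J →ₗ[F] F) (i : ℕ) :
    NonUnitalSubalgebra F R :=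
  lStep J lam (sChainAux J lam i).1 (sChainAux J lam i).2

/-- The terminal element `𝔰̄_λ` of the descending chain; the chain has stabilized by
stage `|R|` since it is a weakly decreasing chain of subalgebras of the finite algebra. -/
def sbar (J : NonUnitalSubalgebra F R) (lam : ↥J →ₗ[F] F) : NonUnitalSubalgebra F R :=
  sChain J lam (Fintype.card R)

theorem sbar_le (J : NonUnitalSubalgebra F R) (lam : ↥J →ₗ[F] F) : sbar J lam ≤ J :=
  (sChainAux J lam (Fintype.card R)).2

/-- The terminal element `𝔩̄_λ` of the ascending chain. -/
def lbar (J : NonUnitalSubalgebra F R) (lam : ↥J →ₗ[F] F) : NonUnitalSubalgebra F R :=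
  lStep J lam (sbar J lam) (sbar_le J lam)

theorem lbar_le (J : NonUnitalSubalgebra F R) (lam : ↥J →ₗ[F] F) : lbar J lam ≤ J :=
  le_trans (lStep_le J lam _ _) (sbar_le J lam)

/-! ### Algebra subgroups of an algebra group -/

/-- The algebra subgroup `1 + k` of `1 + J`, as a subgroup of the ambient algebra group. -/
def algSubgroup (k J : NonUnitalSubalgebra F R) : Subgroup ↥(algGroup F R J) :=
  (algGroup F R k).subgroupOf (algGroup F R J)

/-- `L_λ = 1 + 𝔩_λ` as a subgroup of `G`. -/
def Lgrp (J : NonUnitalSubalgebra F R) (lam : ↥J →ₗ[F] F) : Subgroup ↥(algGroup F R J) :=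
  algSubgroup (lone J lam) J

/-- `S_λ = 1 + 𝔰_λ` as a subgroup of `G`. -/
def Sgrp (J : NonUnitalSubalgebra F R) (lam : ↥J →ₗ[F] F) : Subgroup ↥(algGroup F R J) :=
  algSubgroup (sone J lam) J

/-- `L̄_λ = 1 + 𝔩̄_λ` as a subgroup of `G`. -/
def Lbarg (J : NonUnitalSubalgebra F R) (lam : ↥J →ₗ[F] F) : Subgroup ↥(algGroup F R J) :=
  algSubgroup (lbar J lam) J

/-- `S̄_λ = 1 + 𝔰̄_λ` as a subgroup of `G`. -/
def Sbarg (J : NonUnitalSubalgebra F R) (lam : ↥J →ₗ[F] F) : Subgroup ↥(algGroup F R J) :=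
  algSubgroup (sbar J lam) J

/-- Passing from an element of the subgroup `1 + k ≤ 1 + J` to an element of the
algebra group `1 + k` in its own right. -/
def toAlg {k J : NonUnitalSubalgebra F R} (x : ↥(algSubgroup k J)) : ↥(algGroup F R k) :=
  ⟨((x : ↥(algGroup F R J)) : Rˣ), Subgroup.mem_subgroupOf.mp x.2⟩

/-- The linear inclusion of a smaller subalgebra. -/
def inclMap {s J : NonUnitalSubalgebra F R} (h : s ≤ J) : ↥s →ₗ[F] ↥J where
  toFun x := ⟨(x : R), h x.2⟩
  map_add' x y := rfl
  map_smul' c x := rfl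

/-- Restriction of a functional on `J` to a smaller subalgebra. -/
def resTo {s J : NonUnitalSubalgebra F R} (h : s ≤ J) (lam : ↥J →ₗ[F] F) : ↥s →ₗ[F] F :=
  lam.comp (inclMap h)

/-- The character `ξ_λ = Ind_{L̄_λ}^G (θ_λ)`. -/
def xi (θ : AddChar F ℂ) (J : NonUnitalSubalgebra F R) (lam : ↥J →ₗ[F] F) :
    ↥(algGroup F R J) → ℂ :=
  indFun (Lbarg J lam) (fun x => thetaFn θ J lam ↑x)

/-- The set `Ξ_λ = {g λ s g⁻¹ : g ∈ G, s ∈ S̄_λ}`. -/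
def Xi (J : NonUnitalSubalgebra F R) (lam : ↥J →ₗ[F] F) : Set (↥J →ₗ[F] F) :=
  {nu | ∃ g : ↥(algGroup F R J), ∃ s ∈ Sbarg J lam, nu = coAct g (rightAct s lam)}

/-! ### Normality of algebra subgroups coming from ideals -/

theorem conj_mem_aux (s a : NonUnitalSubalgebra F R)
    (hl : ∀ x ∈ s, ∀ y ∈ a, x * y ∈ a) (hr : ∀ y ∈ a, ∀ x ∈ s, y * x ∈ a)
    (u : Rˣ) (hu1 : (u : R) - 1 ∈ s) (hu2 : ((u⁻¹ : Rˣ) : R) - 1 ∈ s)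
    (x : Rˣ) (hx : (x : R) - 1 ∈ a) : ((u * x * u⁻¹ : Rˣ) : R) - 1 ∈ a := by
  have h1 : (u : R) * ((u⁻¹ : Rˣ) : R) = 1 := Units.mul_inv u
  have key : ((u * x * u⁻¹ : Rˣ) : R) - 1 =
      ((u : R) - 1) * ((x : R) - 1) * (((u⁻¹ : Rˣ) : R) - 1) +
        ((u : R) - 1) * ((x : R) - 1) + ((x : R) - 1) * (((u⁻¹ : Rˣ) : R) - 1) +
        ((x : R) - 1) := by
    push_cast
    calc (u : R) * (x : R) * ((u⁻¹ : Rˣ) : R) - 1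
        = (u : R) * (x : R) * ((u⁻¹ : Rˣ) : R) - (u : R) * ((u⁻¹ : Rˣ) : R) := by rw [h1]
      _ = _ := by noncomm_ring
  rw [key]
  exact add_mem (add_mem (add_mem (hr _ (hl _ hu1 _ hx) _ hu2) (hl _ hu1 _ hx))
    (hr _ hx _ hu2)) hx

theorem algSubgroup_normal (s a : NonUnitalSubalgebra F R)
    (hl : ∀ x ∈ s, ∀ y ∈ a, x * y ∈ a) (hr : ∀ y ∈ a, ∀ x ∈ s, y * x ∈ a) :
    ((algGroup F R a).subgroupOf (algGroup F R s)).Normal := by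
  constructor
  intro n hn g
  rw [Subgroup.mem_subgroupOf] at hn ⊢
  have hginv : ((g⁻¹ : ↥(algGroup F R s)) : Rˣ) = ((g : Rˣ))⁻¹ := rfl
  have hcoe : ((g * n * g⁻¹ : ↥(algGroup F R s)) : Rˣ) = (g : Rˣ) * (n : Rˣ) * ((g : Rˣ))⁻¹ := by
    push_cast [hginv]; rfl
  rw [mem_algGroup]
  constructor
  · rw [hcoe]
    exact conj_mem_aux s a hl hr (g : Rˣ) (g : ↥(algGroup F R s)).2.1 (g : ↥(algGroup F R s)).2.2
      (n : Rˣ) hn.1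
  · have hinv : (((g * n * g⁻¹ : ↥(algGroup F R s)) : Rˣ))⁻¹ =
        (g : Rˣ) * ((n : Rˣ))⁻¹ * ((g : Rˣ))⁻¹ := by
      rw [hcoe]; group
    rw [hinv]
    exact conj_mem_aux s a hl hr (g : Rˣ) (g : ↥(algGroup F R s)).2.1 (g : ↥(algGroup F R s)).2.2
      ((n : Rˣ))⁻¹ hn.2

theorem lone_mul_mem (J : NonUnitalSubalgebra F R) (lam : ↥J →ₗ[F] F)
    {y z : R} (hy : y ∈ lone J lam) (hz : z ∈ J) : y * z ∈ lone J lam := by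
  refine ⟨J.mul_mem (lone_le J lam hy) hz, fun w hw => ?_⟩
  rw [mul_assoc]
  exact hy.2 (z * w) (J.mul_mem hz hw)

theorem sone_mul_lone_mem (J : NonUnitalSubalgebra F R) (lam : ↥J →ₗ[F] F)
    {x y : R} (hx : x ∈ sone J lam) (hy : y ∈ lone J lam) : x * y ∈ lone J lam := by
  refine ⟨J.mul_mem (sone_le J lam hx) (lone_le J lam hy), fun w hw => ?_⟩
  rw [mul_assoc]
  exact hx.2 (y * w) (lone_mul_mem J lam hy hw)

theorem kone_ideal_left (J : NonUnitalSubalgebra F R) (lam : ↥J →ₗ[F] F) :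
    ∀ x ∈ sone J lam, ∀ y ∈ kone J lam, x * y ∈ kone J lam := by
  intro x hx y hy
  exact ⟨sone_mul_lone_mem J lam hx hy.1, hx.2 y hy.1⟩

theorem kone_ideal_right (J : NonUnitalSubalgebra F R) (lam : ↥J →ₗ[F] F) :
    ∀ y ∈ kone J lam, ∀ x ∈ sone J lam, y * x ∈ kone J lam := by
  intro y hy x hx
  exact ⟨lone_mul_mem J lam hy.1 (sone_le J lam hx), hy.1.2 x (sone_le J lam hx)⟩

/-- `K_λ = 1 + 𝔨_λ` as a (normal) subgroup of `S_λ = 1 + 𝔰_λ`. -/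
def KgrpIn (J : NonUnitalSubalgebra F R) (lam : ↥J →ₗ[F] F) :
    Subgroup ↥(algGroup F R (sone J lam)) :=
  (algGroup F R (kone J lam)).subgroupOf (algGroup F R (sone J lam))

instance KgrpIn_normal (J : NonUnitalSubalgebra F R) (lam : ↥J →ₗ[F] F) :
    (KgrpIn J lam).Normal :=
  algSubgroup_normal (sone J lam) (kone J lam) (kone_ideal_left J lam) (kone_ideal_right J lam)

/-- `L_λ = 1 + 𝔩_λ` as a (normal) subgroup of `S_λ = 1 + 𝔰_λ`. -/
def LgrpIn (J : NonUnitalSubalgebra F R) (lam : ↥J →ₗ[F] F) :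
    Subgroup ↥(algGroup F R (sone J lam)) :=
  (algGroup F R (lone J lam)).subgroupOf (algGroup F R (sone J lam))

instance LgrpIn_normal (J : NonUnitalSubalgebra F R) (lam : ↥J →ₗ[F] F) :
    (LgrpIn J lam).Normal :=
  algSubgroup_normal (sone J lam) (lone J lam)
    (fun x hx y hy => sone_mul_lone_mem J lam hx hy)
    (fun y hy x hx => lone_mul_mem J lam hy (sone_le J lam hx))

/-! ### Fibres of the restriction of functionals -/

section Functionals

variable {V W : Type} [AddCommGroup V] [Module F V] [AddCommGroup W] [Module F W]

/-- The functionals restricting to a given `κ` along an injection `W → V` number `|V| / |W|`. -/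
theorem card_extensions_mul_card [Finite V] (f : W →ₗ[F] V) (hf : Function.Injective f)
    (κ : W →ₗ[F] F) :
    Nat.card ↥{ν : V →ₗ[F] F | ν.comp f = κ} * Nat.card W = Nat.card V := by
  have : Finite W := Finite.of_injective f hf
  have card_dual : ∀ (U : Type) [AddCommGroup U] [Module F U] [Finite U],
      Nat.card (U →ₗ[F] F) = Nat.card U := by
    intro U _ _ _
    rw [Module.natCard_eq_pow_finrank (K := F) (V := U →ₗ[F] F),
      Module.natCard_eq_pow_finrank (K := F) (V := U)]
    exact congrArg _ Subspace.dual_finrank_eq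
  have hsurj : Function.Surjective f.dualMap := LinearMap.dualMap_surjective_of_injective hf
  obtain ⟨ν₀, hν₀⟩ := hsurj κ
  have e : ↥{ν : V →ₗ[F] F | ν.comp f = κ} ≃ f.dualMap.toAddMonoidHom.ker :=
    { toFun := fun ν => ⟨ν.1 - ν₀, by
        have h : f.dualMap ν.1 = κ := ν.2
        change f.dualMap (ν.1 - ν₀) = 0
        rw [map_sub, h, hν₀, sub_self]⟩
      invFun := fun μ => ⟨μ.1 + ν₀, by
        have h : f.dualMap μ.1 = 0 := μ.2
        change f.dualMap (μ.1 + ν₀) = κ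
        rw [map_add, h, hν₀, zero_add]⟩
      left_inv := fun ν => by simp
      right_inv := fun μ => by simp }
  have hker := AddSubgroup.card_mul_index f.dualMap.toAddMonoidHom.ker
  rw [AddSubgroup.index_ker, AddMonoidHom.range_eq_top.mpr hsurj, AddSubgroup.card_top] at hker
  rw [Nat.card_congr e, ← card_dual V, ← hker]
  exact congrArg _ (card_dual W).symm

/-- A sum of `θ_ν` over the functionals `ν` restricting to `κ` vanishes off `W`. -/
theorem finsum_extensions_eq_zero [Finite V] (θ : AddChar F ℂ) (hθ : θ ≠ 1) (f : W →ₗ[F] V)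
    (κ : W →ₗ[F] F) {x : V} (hx : x ∉ LinearMap.range f) :
    ∑ᶠ ν ∈ {ν : V →ₗ[F] F | ν.comp f = κ}, θ (ν x) = 0 := by
  obtain ⟨a, ha⟩ := AddChar.ne_one_iff.mp hθ
  have : Finite (V →ₗ[F] F) := DFunLike.finite _
  obtain ⟨φ, hφx, hφ⟩ := Submodule.exists_le_ker_of_notMem hx
  set μ : V →ₗ[F] F := (a * (φ x)⁻¹) • φ with hμ
  have hμx : μ x = a := by simp [hμ, hφx]
  have hμf : μ.comp f = 0 := by
    ext w
    have : φ (f w) = 0 := hφ (LinearMap.mem_range_self f w)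
    simp [hμ, this]
  have key : ∑ᶠ ν ∈ {ν : V →ₗ[F] F | ν.comp f = κ}, θ (ν x) =
      θ a * ∑ᶠ ν ∈ {ν : V →ₗ[F] F | ν.comp f = κ}, θ (ν x) := by
    rw [mul_finsum_mem]
    refine (finsum_mem_eq_of_bijOn (fun ν => μ + ν) ⟨?_, ?_, ?_⟩ ?_).symm
    · intro ν hν
      change (μ + ν).comp f = κ
      rw [LinearMap.add_comp, hμf, zero_add]
      exact hν
    · exact (add_right_injective μ).injOn
    · intro ν hν
      refine ⟨ν - μ, ?_, add_sub_cancel μ ν⟩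
      change (ν - μ).comp f = κ
      rw [LinearMap.sub_comp, hμf, sub_zero]
      exact hν
    · intro ν _
      rw [LinearMap.add_apply, hμx, AddChar.map_add_eq_mul]
  have : (1 - θ a) * ∑ᶠ ν ∈ {ν : V →ₗ[F] F | ν.comp f = κ}, θ (ν x) = 0 := by
    rw [sub_mul, one_mul, ← key, sub_self]
  exact (mul_eq_zero.mp this).resolve_left (sub_ne_zero.mpr ha.symm)

/-- A sum of `θ_ν` over the functionals `ν` restricting to `κ` is a multiple of `θ_κ` on `W`. -/
theorem finsum_extensions_apply [Finite V] (θ : AddChar F ℂ) (f : W →ₗ[F] V)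
    (κ : W →ₗ[F] F) (w : W) :
    ∑ᶠ ν ∈ {ν : V →ₗ[F] F | ν.comp f = κ}, θ (ν (f w)) =
      Nat.card ↥{ν : V →ₗ[F] F | ν.comp f = κ} * θ (κ w) := by
  have : Finite (V →ₗ[F] F) := DFunLike.finite _
  have h : ∀ ν ∈ {ν : V →ₗ[F] F | ν.comp f = κ}, θ (ν (f w)) = θ (κ w) := by
    intro ν hν
    rw [← show ν.comp f = κ from hν, LinearMap.comp_apply]
  rw [finsum_mem_congr rfl h, finsum_mem_eq_finite_toFinset_sum _ (Set.toFinite _),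
    Finset.sum_const, nsmul_eq_mul, ← Set.ncard_eq_toFinset_card, Nat.card_coe_set_eq]

end Functionals

/-! ### Algebra groups of nilpotent subalgebras -/

theorem IsNil.mono {k J : NonUnitalSubalgebra F R} (hJ : IsNil J) (h : k ≤ J) : IsNil k := by
  obtain ⟨N, hN⟩ := hJ
  exact ⟨N, fun l hl => hN l fun x hx => h (hl x hx)⟩

theorem mem_algGroup_iff {J : NonUnitalSubalgebra F R} {u : Rˣ} :
    u ∈ algGroup F R J ↔ (u : R) - 1 ∈ J := by
  refine ⟨fun h => h.1, fun h => ⟨h, ?_⟩⟩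
  have hpow : ∀ n : ℕ, ((u ^ n : Rˣ) : R) - 1 ∈ J := by
    intro n
    induction n with
    | zero => simp
    | succ n ih =>
      have e : ((u ^ (n + 1) : Rˣ) : R) - 1 =
          (((u ^ n : Rˣ) : R) - 1) * ((u : R) - 1) + (((u ^ n : Rˣ) : R) - 1)
            + ((u : R) - 1) := by
        rw [pow_succ, Units.val_mul]; noncomm_ring
      rw [e]
      exact add_mem (add_mem (mul_mem ih h) ih) h
  have hfin : IsOfFinOrder u := isOfFinOrder_of_finite u
  rw [show u⁻¹ = u ^ (orderOf u - 1) from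
    inv_eq_of_mul_eq_one_left (by
      rw [← pow_succ, Nat.sub_add_cancel hfin.orderOf_pos, pow_orderOf_eq_one])]
  exact hpow _

theorem algGroup_mono {k J : NonUnitalSubalgebra F R} (h : k ≤ J) :
    algGroup F R k ≤ algGroup F R J :=
  fun _ hu => ⟨h hu.1, h hu.2⟩

theorem gElt_bijective {J : NonUnitalSubalgebra F R} (hJ : IsNil J) :
    Function.Bijective (gElt (J := J)) := by
  constructor
  · intro u v huv
    have h : ((u : Rˣ) : R) - 1 = ((v : Rˣ) : R) - 1 := congrArg Subtype.val huv
    exact Subtype.ext (Units.ext (sub_left_injective h))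
  · intro X
    obtain ⟨N, hN⟩ := hJ
    have hnil : IsNilpotent (X : R) := ⟨N, by
      rw [← List.prod_replicate]
      refine hN _ (fun x hx => ?_) List.length_replicate
      rw [List.eq_of_mem_replicate hx]
      exact X.2⟩
    obtain ⟨u, hu⟩ := hnil.isUnit_one_add
    have hX : (u : R) - 1 = X := by rw [hu, add_sub_cancel_left]
    exact ⟨⟨u, mem_algGroup_iff.mpr (hX ▸ X.2)⟩, Subtype.ext hX⟩

theorem card_algGroup {J : NonUnitalSubalgebra F R} (hJ : IsNil J) :
    Nat.card ↥(algGroup F R J) = Nat.card ↥J :=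
  Nat.card_congr (Equiv.ofBijective _ (gElt_bijective hJ))

theorem card_algSubgroup {k J : NonUnitalSubalgebra F R} (hJ : IsNil J) (h : k ≤ J) :
    Nat.card ↥(algSubgroup k J) = Nat.card ↥k := by
  rw [← card_algGroup (hJ.mono h)]
  exact Nat.card_congr (Subgroup.subgroupOfEquivOfLe (algGroup_mono h)).toEquiv

/-! ### The right orbit and its restriction -/

theorem inclMap_injective {s J : NonUnitalSubalgebra F R} (h : s ≤ J) :
    Function.Injective (inclMap (F := F) h) :=
  fun _ _ hxy => Subtype.ext (congrArg (fun z : ↥J => (z : R)) hxy)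

theorem mem_range_inclMap {s J : NonUnitalSubalgebra F R} (h : s ≤ J) {x : ↥J} :
    x ∈ LinearMap.range (inclMap (F := F) h) ↔ (x : R) ∈ s :=
  ⟨fun ⟨y, hy⟩ => hy ▸ y.2, fun hx => ⟨⟨x, hx⟩, rfl⟩⟩

theorem lone_le_sone (J : NonUnitalSubalgebra F R) (lam : ↥J →ₗ[F] F) :
    lone J lam ≤ sone J lam :=
  fun _ hx => ⟨hx.1, fun y hy => hx.2 y hy.1⟩

/-- The right orbit of `λ` is the set of functionals agreeing with `λ` on `𝔩_λ`. -/
theorem mem_rightOrbit_iff {J : NonUnitalSubalgebra F R} (hJ : IsNil J) {lam ν : ↥J →ₗ[F] F} :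
    ν ∈ rightOrbit J lam ↔ resTo (lone_le J lam) ν = resTo (lone_le J lam) lam := by
  have hact : ∀ (g : ↥(algGroup F R J)) (X : ↥J),
      rightAct g lam X = lam X + lam (X * gElt g⁻¹) := by
    intro g X
    rw [← map_add]
    refine congrArg lam (Subtype.ext ?_)
    change (X : R) * ((g⁻¹ : Rˣ) : R) = (X : R) + (X : R) * (((g⁻¹ : Rˣ) : R) - 1)
    noncomm_ring
  constructor
  · rintro ⟨g, rfl⟩
    ext X
    change rightAct g lam _ = lam _
    rw [hact, add_eq_left]
    have h := X.2.2 (gElt g⁻¹ : ↥J) (gElt g⁻¹).2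
    rwa [lamE_apply J lam (J.mul_mem X.2.1 (gElt g⁻¹).2)] at h
  · intro h
    let B : ↥J →ₗ[F] Module.Dual F ↥J := (LinearMap.mul F ↥J).flip.compr₂ lam
    have hB : ∀ X Y, B Y X = lam (X * Y) := fun _ _ => rfl
    have hmem : ν - lam ∈ LinearMap.range B := by
      rw [← Subspace.dualCoannihilator_dualAnnihilator_eq (W := LinearMap.range B),
        Submodule.mem_dualAnnihilator]
      intro X hX
      have hXl : (X : R) ∈ lone J lam := by
        refine ⟨X.2, fun y hy => ?_⟩
        rw [lamE_apply J lam (J.mul_mem X.2 hy)]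
        exact (Submodule.mem_dualCoannihilator X).mp hX _ (LinearMap.mem_range_self B ⟨y, hy⟩)
      have := LinearMap.congr_fun h ⟨X, hXl⟩
      rw [LinearMap.sub_apply, sub_eq_zero]
      exact this
    obtain ⟨Y, hY⟩ := hmem
    obtain ⟨g, rfl⟩ := (gElt_bijective hJ).2 Y
    refine ⟨g⁻¹, LinearMap.ext fun X => ?_⟩
    have := LinearMap.congr_fun hY X
    rw [hB, LinearMap.sub_apply] at this
    change rightAct g⁻¹ lam X = ν X
    rw [hact, inv_inv, this, add_sub_cancel]

/-- The restriction of the right orbit to `𝔰_λ` consists of the functionals agreeing with `λ`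
on `𝔩_λ`. -/
theorem resTo_image_rightOrbit {J : NonUnitalSubalgebra F R} (hJ : IsNil J)
    (lam : ↥J →ₗ[F] F) :
    resTo (sone_le J lam) '' rightOrbit J lam =
      {ν | ν.comp (inclMap (lone_le_sone J lam)) = resTo (lone_le J lam) lam} := by
  ext κ
  constructor
  · rintro ⟨ν, hν, rfl⟩
    exact (mem_rightOrbit_iff hJ).mp hν
  · intro hκ
    obtain ⟨ν, rfl⟩ := LinearMap.dualMap_surjective_of_injective
      (inclMap_injective (sone_le J lam)) κ
    exact ⟨ν, (mem_rightOrbit_iff hJ).mpr hκ, rfl⟩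

/-! ### The induced character -/

/-- `λ` is invariant under conjugation of `𝔩_λ` by elements of `S_λ`. -/
theorem lone_conj (J : NonUnitalSubalgebra F R) (lam : ↥J →ₗ[F] F) (u : Rˣ)
    (hu : u ∈ algGroup F R (sone J lam)) {x : R} (hx : x ∈ lone J lam) :
    (u : R) * x * ((u⁻¹ : Rˣ) : R) ∈ lone J lam ∧
      lamE J lam ((u : R) * x * ((u⁻¹ : Rˣ) : R)) = lamE J lam x := by
  have hleft := sone_mul_lone_mem J lam hu.1 hx
  have hux : ((u : R) - 1) * x + x ∈ lone J lam := add_mem hleft hx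
  have hu' : ((u⁻¹ : Rˣ) : R) - 1 ∈ J := sone_le J lam hu.2
  have hright := lone_mul_mem J lam hux hu'
  have e : (u : R) * x * ((u⁻¹ : Rˣ) : R) =
      (((u : R) - 1) * x + x) * (((u⁻¹ : Rˣ) : R) - 1) + (((u : R) - 1) * x + x) := by
    noncomm_ring
  rw [e]
  refine ⟨add_mem hright hux, ?_⟩
  rw [lamE_add J lam (lone_le J lam hright) (lone_le J lam hux), hux.2 _ hu',
    lamE_add J lam (lone_le J lam hleft) (lone_le J lam hx), hu.1.2 x hx, zero_add, zero_add]

theorem conj_sub_one (u s : Rˣ) :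
    ((u * s * u⁻¹ : Rˣ) : R) - 1 = (u : R) * ((s : R) - 1) * ((u⁻¹ : Rˣ) : R) := by
  rw [mul_sub, sub_mul, mul_one, Units.mul_inv, Units.val_mul, Units.val_mul]

theorem thetaFn_eq_lamE (θ : AddChar F ℂ) (J : NonUnitalSubalgebra F R) (lam : ↥J →ₗ[F] F)
    (g : ↥(algGroup F R J)) : thetaFn θ J lam g = θ (lamE J lam (((g : Rˣ) : R) - 1)) := by
  rw [lamE_apply J lam g.2.1]
  rfl

theorem mem_Lgrp_subgroupOf_iff {J : NonUnitalSubalgebra F R} {lam : ↥J →ₗ[F] F}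
    {s : ↥(Sgrp J lam)} :
    s ∈ (Lgrp J lam).subgroupOf (Sgrp J lam) ↔
      (((s : ↥(algGroup F R J)) : Rˣ) : R) - 1 ∈ lone J lam := by
  rw [Subgroup.mem_subgroupOf, Lgrp, algSubgroup, Subgroup.mem_subgroupOf, mem_algGroup_iff]

theorem conj_sub_one_mem_lone {J : NonUnitalSubalgebra F R} {lam : ↥J →ₗ[F] F}
    {s : ↥(Sgrp J lam)} (x : ↥(Sgrp J lam))
    (hs : s ∈ (Lgrp J lam).subgroupOf (Sgrp J lam)) :
    x * s * x⁻¹ ∈ (Lgrp J lam).subgroupOf (Sgrp J lam) ∧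
      lamE J lam ((((x * s * x⁻¹ : ↥(Sgrp J lam)) : ↥(algGroup F R J)) : Rˣ) - 1 : R) =
        lamE J lam ((((s : ↥(algGroup F R J)) : Rˣ) : R) - 1) := by
  have h := lone_conj J lam ((x : ↥(algGroup F R J)) : Rˣ) (toAlg x).2
    (mem_Lgrp_subgroupOf_iff.mp hs)
  rw [← conj_sub_one] at h
  exact ⟨mem_Lgrp_subgroupOf_iff.mpr h.1, h.2⟩

instance Lgrp_subgroupOf_normal (J : NonUnitalSubalgebra F R) (lam : ↥J →ₗ[F] F) :
    ((Lgrp J lam).subgroupOf (Sgrp J lam)).Normal :=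
  ⟨fun _ hs x => (conj_sub_one_mem_lone x hs).1⟩

theorem indFun_Lgrp_of_mem {J : NonUnitalSubalgebra F R} (θ : AddChar F ℂ) (lam : ↥J →ₗ[F] F)
    {s : ↥(Sgrp J lam)} (hs : s ∈ (Lgrp J lam).subgroupOf (Sgrp J lam)) :
    indFun ((Lgrp J lam).subgroupOf (Sgrp J lam))
        (fun x => thetaFn θ J lam ((x : ↥(Sgrp J lam)) : ↥(algGroup F R J))) s =
      (Nat.card ↥((Lgrp J lam).subgroupOf (Sgrp J lam)) : ℂ)⁻¹ *
        (Nat.card ↥(Sgrp J lam) * thetaFn θ J lam (s : ↥(algGroup F R J))) := by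
  rw [indFun]
  congr 1
  have h : ∀ x : ↥(Sgrp J lam),
      (if h : x * s * x⁻¹ ∈ (Lgrp J lam).subgroupOf (Sgrp J lam) then
        thetaFn θ J lam ((x * s * x⁻¹ : ↥(Sgrp J lam)) : ↥(algGroup F R J)) else 0) =
        thetaFn θ J lam (s : ↥(algGroup F R J)) := by
    intro x
    rw [dif_pos (conj_sub_one_mem_lone x hs).1, thetaFn_eq_lamE, thetaFn_eq_lamE,
      (conj_sub_one_mem_lone x hs).2]
  rw [finsum_congr h, finsum_eq_sum_of_fintype, Finset.sum_const, nsmul_eq_mul,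
    Finset.card_univ, Nat.card_eq_fintype_card]

theorem indFun_of_notMem {G : Type} [Group G] (H : Subgroup G) [H.Normal] (ψ : ↥H → ℂ) {g : G}
    (hg : g ∉ H) : indFun H ψ g = 0 := by
  have h : ∀ x : G, (if h : x * g * x⁻¹ ∈ H then ψ ⟨x * g * x⁻¹, h⟩ else 0) = 0 := by
    intro x
    refine dif_neg fun hx => hg ?_
    have := Subgroup.Normal.conj_mem ‹H.Normal› _ hx x⁻¹
    rwa [show x⁻¹ * (x * g * x⁻¹) * x⁻¹⁻¹ = g by group] at this
  rw [indFun, finsum_congr h, finsum_zero, mul_zero]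

theorem statement5 (F : Type) [Field F] [Fintype F]
    (R : Type) [Ring R] [Algebra F R] [Fintype R]
    (J : NonUnitalSubalgebra F R) (hJ : IsNil J)
    (θ : AddChar F ℂ) (hθ : θ ≠ 1)
    (lam : ↥J →ₗ[F] F) :
    (∀ s : ↥(Sgrp J lam),
      indFun ((Lgrp J lam).subgroupOf (Sgrp J lam))
          (fun x => thetaFn θ J lam ((x : ↥(Sgrp J lam)) : ↥(algGroup F R J))) s =
        ∑ᶠ ν ∈ resTo (sone_le J lam) '' rightOrbit J lam,
          thetaFn θ (sone J lam) ν (toAlg s)) ∧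
    (∀ κ : ↥(sone J lam) →ₗ[F] F,
      {ν | ν ∈ rightOrbit J lam ∧ resTo (sone_le J lam) ν = κ} = ∅ ∨
      Nat.card ↥{ν | ν ∈ rightOrbit J lam ∧ resTo (sone_le J lam) ν = κ} *
          Nat.card ↥(algGroup F R (sone J lam)) = Nat.card ↥(algGroup F R J)) := by
  constructor
  · intro s
    have hsum : ∑ᶠ ν ∈ resTo (sone_le J lam) '' rightOrbit J lam,
        thetaFn θ (sone J lam) ν (toAlg s) =
        ∑ᶠ ν ∈ {ν : ↥(sone J lam) →ₗ[F] F |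
          ν.comp (inclMap (lone_le_sone J lam)) = resTo (lone_le J lam) lam},
          θ (ν (gElt (toAlg s))) := by
      rw [resTo_image_rightOrbit hJ]
      rfl
    rw [hsum]
    by_cases hs : s ∈ (Lgrp J lam).subgroupOf (Sgrp J lam)
    · have hs' := mem_Lgrp_subgroupOf_iff.mp hs
      have hL : Nat.card ↥((Lgrp J lam).subgroupOf (Sgrp J lam)) = Nat.card ↥(lone J lam) := by
        rw [← card_algSubgroup hJ (lone_le J lam)]
        exact Nat.card_congr (Subgroup.subgroupOfEquivOfLe
          (show Lgrp J lam ≤ Sgrp J lam from fun _ hx => algGroup_mono (lone_le_sone J lam) hx)).toEquiv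
      have hS : Nat.card ↥(Sgrp J lam) = Nat.card ↥(sone J lam) :=
        card_algSubgroup hJ (sone_le J lam)
      have hcard := card_extensions_mul_card _ (inclMap_injective (lone_le_sone J lam))
        (resTo (lone_le J lam) lam)
      have hval := finsum_extensions_apply θ (inclMap (lone_le_sone J lam))
        (resTo (lone_le J lam) lam) ⟨_, hs'⟩
      have hne : (Nat.card ↥(lone J lam) : ℂ) ≠ 0 := Nat.cast_ne_zero.mpr Nat.card_pos.ne'
      rw [indFun_Lgrp_of_mem θ lam hs, hL, hS, ← hcard,
        Nat.cast_mul, inv_mul_eq_iff_eq_mul₀ hne, mul_comm (Nat.cast _) (Nat.cast _), mul_assoc]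
      exact congrArg _ hval.symm
    · rw [indFun_of_notMem _ _ hs, finsum_extensions_eq_zero θ hθ]
      rw [mem_range_inclMap]
      exact fun h => hs (mem_Lgrp_subgroupOf_iff.mpr h)
  · intro κ
    rw [card_algGroup hJ, card_algGroup (hJ.mono (sone_le J lam))]
    by_cases hκ : κ.comp (inclMap (lone_le_sone J lam)) = resTo (lone_le J lam) lam
    · right
      have hset : {ν | ν ∈ rightOrbit J lam ∧ resTo (sone_le J lam) ν = κ} =
          {ν : ↥J →ₗ[F] F | ν.comp (inclMap (sone_le J lam)) = κ} := by
        ext ν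
        refine ⟨fun h => h.2, fun h => ⟨(mem_rightOrbit_iff hJ).mpr ?_, h⟩⟩
        rw [← hκ, ← show ν.comp (inclMap (sone_le J lam)) = κ from h]
        rfl
      rw [hset]
      exact card_extensions_mul_card _ (inclMap_injective (sone_le J lam)) κ
    · left
      refine Set.eq_empty_of_forall_notMem ?_
      rintro ν ⟨hν, rfl⟩
      exact hκ ((mem_rightOrbit_iff hJ).mp hν)

end IterChar
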